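/- arXiv:1110.6031 — 3 statements merged into one kernel-verified Lean document; each statement's English description precedes it below -/
import Mathlib

section
/- There exists a constant C > 0 (depending only on C₀) such that for every Schwartz function f and every x ∈ ℝ, Σ_{k∈ℤ} |f_k(x)|² ≤ C (|f|² * |W_L|)(x). -/
open MeasureTheory Real Set
open scoped ENNReal NNReal

noncomputable section

/-- The Fourier transform `f̂(ξ) = ∫ f(x) e^{-ixξ} dx`. -/
def FTr (f : ℝ → ℂ) : ℝ → ℂ := fun ξ =>
  ∫ x : ℝ, f x * Complex.exp (-(Complex.I * x * ξ))

/-- The piece `f_k`, realised as convolution of `f` with `e^{ikL·} W_L`, whose Fourier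
transform is `Ŵ_L(ξ − kL)`; thus `f̂_k(ξ) = f̂(ξ) Ŵ_L(ξ − kL)`. -/
def ESpiece (W : ℝ → ℂ) (L : ℝ) (k : ℤ) (f : ℝ → ℂ) : ℝ → ℂ := fun x =>
  ∫ y : ℝ, f y * (Complex.exp (Complex.I * k * L * (x - y)) * W (x - y))

lemma aux_exp_int (m : ℤ) :
    ∫ u in (0:ℝ)..1, Complex.exp (2 * π * Complex.I * m * u) = if m = 0 then 1 else 0 := by
  split_ifs with h
  · simp [h]
  · have hc : (2 * π * Complex.I * m : ℂ) ≠ 0 := by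
      simp [h, Complex.I_ne_zero, Real.pi_ne_zero]
    rw [integral_exp_mul_complex hc]
    have : Complex.exp (2 * π * Complex.I * m * ((1:ℝ):ℂ)) = 1 := by
      rw [Complex.exp_eq_one_iff]
      exact ⟨m, by push_cast; ring⟩
    rw [this]
    simp

lemma aux_orth (S : Finset ℤ) (a : ℤ → ℂ) :
    ∫ u in (0:ℝ)..1, ‖∑ k ∈ S, (starRingEnd ℂ) (a k) * Complex.exp (2 * π * Complex.I * k * u)‖ ^ 2
      = ∑ k ∈ S, ‖a k‖ ^ 2 := by
  have key : ∀ u : ℝ,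
      ((‖∑ k ∈ S, (starRingEnd ℂ) (a k) * Complex.exp (2 * π * Complex.I * k * u)‖ ^ 2 : ℝ) : ℂ)
      = ∑ k ∈ S, ∑ j ∈ S, ((starRingEnd ℂ) (a k) * a j) *
          Complex.exp (2 * π * Complex.I * ((k - j : ℤ) : ℂ) * u) := by
    intro u
    push_cast
    rw [← Complex.mul_conj', map_sum, Finset.sum_mul_sum]
    refine Finset.sum_congr rfl fun k _ => Finset.sum_congr rfl fun j _ => ?_
    rw [map_mul, Complex.conj_conj, ← Complex.exp_conj]
    have : (starRingEnd ℂ) (2 * π * Complex.I * j * u) = -(2 * π * Complex.I * j * u) := by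
      have h2 : (starRingEnd ℂ) (2:ℂ) = 2 := Complex.conj_ofNat 2
      simp [h2]
    rw [this, show (2 * π * Complex.I * ((k:ℂ) - j) * u : ℂ) =
      2 * π * Complex.I * k * u + -(2 * π * Complex.I * j * u) by ring, Complex.exp_add]
    ring
  apply Complex.ofReal_injective
  rw [← intervalIntegral.integral_ofReal]
  simp_rw [key]
  rw [intervalIntegral.integral_finsetSum]
  swap
  · intro i _
    apply Continuous.intervalIntegrable
    fun_prop
  push_cast
  refine Finset.sum_congr rfl fun k hk => ?_
  rw [intervalIntegral.integral_finsetSum]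
  swap
  · intro i _
    apply Continuous.intervalIntegrable
    fun_prop
  simp_rw [intervalIntegral.integral_const_mul]
  have := fun j => aux_exp_int (k - j)
  push_cast at this
  simp_rw [this, sub_eq_zero]
  simp [hk, Complex.conj_mul']

lemma aux_summable : Summable (fun n : ℤ => 4 / (1 + |(n:ℝ)|) ^ 2) := by
  have h1 : Summable (fun n : ℕ => 4 / (1 + |(n:ℝ)|) ^ 2) := by
    have := ((summable_nat_add_iff 1).2 (Real.summable_one_div_nat_pow.2 (by norm_num : 1 < 2))).mul_left 4
    refine this.congr fun n => ?_
    rw [abs_of_nonneg (Nat.cast_nonneg n)]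
    push_cast
    ring
  apply Summable.of_nat_of_neg
  · simpa using h1
  · simpa using h1

lemma aux_weight (u : ℝ) (h0 : 0 ≤ u) (h1 : u ≤ 1) (n : ℤ) :
    1 / (1 + 2 * π * |u + n|) ^ 2 ≤ 4 / (1 + |(n:ℝ)|) ^ 2 := by
  have hpi : 1 ≤ 2 * π := by linarith [Real.pi_gt_three]
  have h2 : |(n:ℝ)| ≤ |u + n| + 1 := by
    have := abs_sub (u + n) u
    rw [add_sub_cancel_left, abs_of_nonneg h0] at this
    linarith
  have h3 : |u + n| ≤ 2 * π * |u + n| := le_mul_of_one_le_left (abs_nonneg _) hpi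
  have h4 : (1 + |(n:ℝ)|) / 2 ≤ 1 + 2 * π * |u + n| := by linarith [abs_nonneg (u + n)]
  have h5 : 0 < 1 + |(n:ℝ)| := by positivity
  calc 1 / (1 + 2 * π * |u + n|) ^ 2 ≤ 1 / ((1 + |(n:ℝ)|) / 2) ^ 2 := by gcongr
    _ = _ := by field_simp; norm_num

lemma aux_Qint (C₀ : ℝ) (L : ℝ) (hL : 0 < L) (W : ℝ → ℂ)
    (hI : Integrable W volume) (hW : ∀ x : ℝ, ‖W x‖ ≤ C₀ * L / (1 + L * |x|) ^ 2)
    (S : Finset ℤ) (a : ℤ → ℂ)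
    (hQI : Integrable (fun t : ℝ =>
      ‖∑ k ∈ S, (starRingEnd ℂ) (a k) * Complex.exp (Complex.I * k * L * t)‖ ^ 2 * ‖W t‖)) :
    ∫ t : ℝ, ‖∑ k ∈ S, (starRingEnd ℂ) (a k) * Complex.exp (Complex.I * k * L * t)‖ ^ 2 * ‖W t‖
      ≤ (2 * π * C₀ * ∑' n : ℤ, 4 / (1 + |(n:ℝ)|) ^ 2) * ∑ k ∈ S, ‖a k‖ ^ 2 := by
  set h : ℝ → ℝ := fun t : ℝ =>
      ‖∑ k ∈ S, (starRingEnd ℂ) (a k) * Complex.exp (Complex.I * k * L * t)‖ ^ 2 * ‖W t‖ with hh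
  set T := 2 * π / L with hT
  have hTpos : 0 < T := by positivity
  have hC : 0 ≤ C₀ * L := by
    have := (norm_nonneg _).trans (hW 0)
    simpa using this
  have hsc : ∫ t, h t = T * ∫ u, h (T * u) := by
    rw [Measure.integral_comp_mul_left, abs_of_pos (inv_pos.2 hTpos), smul_eq_mul,
      mul_inv_cancel_left₀ hTpos.ne']
  have hI2 : Integrable (fun u => h (T * u)) := hQI.comp_mul_left' hTpos.ne'
  have hs := hI2.hasSum_intervalIntegral_comp_add_int
  have hle : ∀ n : ℤ, ∫ u in (0:ℝ)..1, h (T * (u + n)) ≤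
      (4 / (1 + |(n:ℝ)|) ^ 2) * (C₀ * L * ∑ k ∈ S, ‖a k‖ ^ 2) := by
    intro n
    rw [← aux_orth S a, ← intervalIntegral.integral_const_mul, ← intervalIntegral.integral_const_mul]
    apply intervalIntegral.integral_mono_on zero_le_one
    · exact (hI2.comp_add_right (n:ℝ)).intervalIntegrable
    · apply Continuous.intervalIntegrable
      fun_prop
    · intro u hu
      simp only [hh]
      have e : ∀ k : ℤ, Complex.exp (Complex.I * k * L * ((T * (u + n) : ℝ) : ℂ)) =
          Complex.exp (2 * π * Complex.I * k * u) := by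
        intro k
        rw [Complex.exp_eq_exp_iff_exists_int]
        refine ⟨k * n, ?_⟩
        have : (L:ℂ) ≠ 0 := by exact_mod_cast hL.ne'
        rw [hT]
        push_cast
        field_simp
      simp_rw [e]
      have hw : ‖W (T * (u + n))‖ ≤ (4 / (1 + |(n:ℝ)|) ^ 2) * (C₀ * L) := by
        refine (hW _).trans ?_
        have : L * |T * (u + n)| = 2 * π * |u + n| := by
          rw [abs_mul, abs_of_pos hTpos, hT]; field_simp
        rw [this]
        have := mul_le_mul_of_nonneg_right (aux_weight u hu.1 hu.2 n) hC
        rwa [one_div_mul_eq_div] at this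
      calc _ ≤ _ := mul_le_mul_of_nonneg_left hw (by positivity)
        _ = _ := by ring
  have := hasSum_le hle hs (aux_summable.hasSum.mul_right _)
  rw [hsc]
  calc _ ≤ _ := mul_le_mul_of_nonneg_left this hTpos.le
    _ = _ := by rw [hT]; field_simp

lemma aux_main (C₀ : ℝ) (hC₀ : 0 < C₀) (L : ℝ) (hL : 0 < L) (W : ℝ → ℂ)
    (hI : Integrable W volume) (hW : ∀ x : ℝ, ‖W x‖ ≤ C₀ * L / (1 + L * |x|) ^ 2)
    (K : ℝ) (hK : K = 2 * π * C₀ * ∑' n : ℤ, 4 / (1 + |(n:ℝ)|) ^ 2) (hKpos : 0 < K)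
    (f : SchwartzMap ℝ ℂ) (x : ℝ) (S : Finset ℤ) :
    Integrable (fun t => ‖f (x - t)‖ ^ 2 * ‖W t‖) ∧
    ∑ k ∈ S, ‖ESpiece W L k (fun y => f y) x‖ ^ 2 ≤ K * ∫ t, ‖f (x - t)‖ ^ 2 * ‖W t‖ := by
  set a : ℤ → ℂ := fun k => ESpiece W L k (fun y => f y) x with ha
  set Q : ℝ → ℂ := fun t => ∑ k ∈ S, (starRingEnd ℂ) (a k) * Complex.exp (Complex.I * k * L * t) with hQ
  have hfc : Continuous fun t : ℝ => f (x - t) := f.continuous.comp (by fun_prop)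
  obtain ⟨M, hM⟩ : ∃ M, ∀ t, ‖f t‖ ≤ M := by
    obtain ⟨M, hM⟩ := f.decay 0 0
    exact ⟨M, fun t => by simpa using hM.2 t⟩
  have hQc : Continuous Q := by rw [hQ]; fun_prop
  have hexp : ∀ (k : ℤ) (t : ℝ), ‖Complex.exp (Complex.I * k * L * t)‖ = 1 := by
    intro k t
    rw [show (Complex.I * k * L * t : ℂ) = ((k * L * t : ℝ) : ℂ) * Complex.I by push_cast; ring]
    exact Complex.norm_exp_ofReal_mul_I _
  have hQb : ∀ t, ‖Q t‖ ≤ ∑ k ∈ S, ‖a k‖ := by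
    intro t
    refine (norm_sum_le _ _).trans (Finset.sum_le_sum fun k _ => ?_)
    rw [norm_mul, hexp]; simp
  have hM0 : 0 ≤ M := (norm_nonneg _).trans (hM 0)
  have i1 : Integrable (fun t => ‖f (x - t)‖ ^ 2 * ‖W t‖) := by
    refine hI.norm.bdd_mul (c := M ^ 2) (by fun_prop) (ae_of_all _ fun t => ?_)
    simp only [norm_pow, norm_norm]
    gcongr
    exact hM _
  have i2 : Integrable (fun t => ‖Q t‖ ^ 2 * ‖W t‖) := by
    refine hI.norm.bdd_mul (c := (∑ k ∈ S, ‖a k‖) ^ 2) (by fun_prop) (ae_of_all _ fun t => ?_)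
    simp only [norm_pow, norm_norm]
    gcongr
    exact hQb _
  have i0 : Integrable (fun t => f (x - t) * W t) :=
    hI.bdd_mul (c := M) hfc.aestronglyMeasurable (ae_of_all _ fun t => hM _)
  have i3 : ∀ k : ℤ, Integrable (fun t : ℝ => Complex.exp (Complex.I * k * L * t) * (f (x - t) * W t)) :=
    fun k => i0.bdd_mul (c := 1) (Continuous.aestronglyMeasurable (by fun_prop))
      (ae_of_all _ fun t => (hexp k t).le)
  refine ⟨i1, ?_⟩
  have hak : ∀ k, a k = ∫ t : ℝ, Complex.exp (Complex.I * k * L * t) * (f (x - t) * W t) := by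
    intro k
    rw [ha]
    simp only [ESpiece]
    rw [← integral_sub_left_eq_self _ volume x]
    refine integral_congr_ae (ae_of_all _ fun t => ?_)
    simp only [sub_sub_cancel]
    push_cast
    rw [sub_sub_cancel]
    ring
  have hA : ((∑ k ∈ S, ‖a k‖ ^ 2 : ℝ) : ℂ) = ∫ t, Q t * (f (x - t) * W t) := by
    simp_rw [hQ, Finset.sum_mul, mul_assoc ((starRingEnd ℂ) _)]
    rw [integral_finsetSum _ fun k _ => (i3 k).const_mul _]
    push_cast
    refine Finset.sum_congr rfl fun k _ => ?_
    rw [integral_const_mul, ← hak, Complex.conj_mul']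
  have hA0 : 0 ≤ ∑ k ∈ S, ‖a k‖ ^ 2 := by positivity
  have hb : ∑ k ∈ S, ‖a k‖ ^ 2 ≤
      ∫ t, (K / 2 * (‖f (x - t)‖ ^ 2 * ‖W t‖) + 1 / (2 * K) * (‖Q t‖ ^ 2 * ‖W t‖)) := by
    rw [← abs_of_nonneg hA0, ← Real.norm_eq_abs, ← Complex.norm_real, hA]
    refine norm_integral_le_of_norm_le ((i1.const_mul _).add (i2.const_mul _))
      (ae_of_all _ fun t => ?_)
    rw [norm_mul, norm_mul]
    have : ‖Q t‖ * ‖f (x - t)‖ ≤ K / 2 * ‖f (x - t)‖ ^ 2 + 1 / (2 * K) * ‖Q t‖ ^ 2 := by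
      have h := sq_nonneg (K * ‖f (x - t)‖ - ‖Q t‖)
      have e : K / 2 * ‖f (x - t)‖ ^ 2 + 1 / (2 * K) * ‖Q t‖ ^ 2 - ‖Q t‖ * ‖f (x - t)‖
        = (K * ‖f (x - t)‖ - ‖Q t‖) ^ 2 / (2 * K) := by field_simp; ring
      have : 0 ≤ (K * ‖f (x - t)‖ - ‖Q t‖) ^ 2 / (2 * K) := by positivity
      linarith
    have := mul_le_mul_of_nonneg_right this (norm_nonneg (W t))
    linarith
  rw [integral_add (i1.const_mul _) (i2.const_mul _), integral_const_mul, integral_const_mul] at hb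
  have hq := aux_Qint C₀ L hL W hI hW S a i2
  rw [← hK] at hq
  have : 1 / (2 * K) * ∫ t, ‖Q t‖ ^ 2 * ‖W t‖ ≤ 1 / (2 * K) * (K * ∑ k ∈ S, ‖a k‖ ^ 2) :=
    mul_le_mul_of_nonneg_left hq (by positivity)
  have e : 1 / (2 * K) * (K * ∑ k ∈ S, ‖a k‖ ^ 2) = (∑ k ∈ S, ‖a k‖ ^ 2) / 2 := by field_simp
  linarith

/-- Pointwise inequality for the equally-spaced square function:
`Σ_k |f_k(x)|² ≤ C (|f|² * |W_L|)(x)` for Schwartz `f`, with `C` depending only on `C₀`. -/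
theorem stmt12 (C₀ : ℝ) (hC₀ : 0 < C₀) :
    ∃ C : ℝ, 0 < C ∧ ∀ (L : ℝ), 0 < L → ∀ (W : ℝ → ℂ), Integrable W volume →
      (∀ ξ : ℝ, ξ ∉ Set.Icc (-2 * L) (2 * L) → FTr W ξ = 0) →
      (∀ x : ℝ, ∑' k : ℤ, FTr W (x - k * L) = 1) →
      (∀ x : ℝ, ‖W x‖ ≤ C₀ * L / (1 + L * |x|) ^ 2) →
      ∀ f : SchwartzMap ℝ ℂ, ∀ x : ℝ,
      ∑' k : ℤ, (‖ESpiece W L k (fun y => f y) x‖₊ : ℝ≥0∞) ^ 2 ≤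
        ENNReal.ofReal C *
          ∫⁻ t : ℝ, (‖f (x - t)‖₊ : ℝ≥0∞) ^ 2 * (‖W t‖₊ : ℝ≥0∞) := by
  have hpos : 0 < ∑' n : ℤ, 4 / (1 + |(n:ℝ)|) ^ 2 :=
    aux_summable.tsum_pos (fun n => by positivity) 0 (by norm_num)
  have hKpos : 0 < 2 * π * C₀ * ∑' n : ℤ, 4 / (1 + |(n:ℝ)|) ^ 2 := by positivity
  refine ⟨_, hKpos, ?_⟩
  intro L hL W hI _ _ hW f x
  rw [ENNReal.tsum_eq_iSup_sum]
  refine iSup_le fun S => ?_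
  obtain ⟨i1, h⟩ := aux_main C₀ hC₀ L hL W hI hW _ rfl hKpos f x S
  have e1 : ∫⁻ t : ℝ, (‖f (x - t)‖₊ : ℝ≥0∞) ^ 2 * (‖W t‖₊ : ℝ≥0∞) =
      ENNReal.ofReal (∫ t, ‖f (x - t)‖ ^ 2 * ‖W t‖) := by
    rw [ofReal_integral_eq_lintegral_ofReal i1 (ae_of_all _ fun t => by positivity)]
    refine lintegral_congr fun t => ?_
    rw [ENNReal.ofReal_mul (by positivity), ENNReal.ofReal_pow (norm_nonneg _),
      ofReal_norm, ofReal_norm]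
    rfl
  have e2 : ∑ k ∈ S, (‖ESpiece W L k (fun y => f y) x‖₊ : ℝ≥0∞) ^ 2 =
      ENNReal.ofReal (∑ k ∈ S, ‖ESpiece W L k (fun y => f y) x‖ ^ 2) := by
    rw [ENNReal.ofReal_sum_of_nonneg (fun k _ => by positivity)]
    refine Finset.sum_congr rfl fun k _ => ?_
    rw [ENNReal.ofReal_pow (norm_nonneg _), ofReal_norm]
    rfl
  rw [e1, e2, ← ENNReal.ofReal_mul hKpos.le]
  exact ENNReal.ofReal_le_ofReal h
end
end

section
/- Let Θ : ℝ → [0,∞) be a Schwartz function, not identically zero, whose Fourier transform is nonnegative, and let a > 0. Then there exists a constant C > 0 (depending only on Θ and a) such that for every L > 0, every δ ≥ a/L, and every continuous w₁ : ℝ → [0,∞), the function w₂(x) = sup_{|x'−x| ≤ δ} w₁(x') satisfies w₂(x) ≤ C (Θ_L * w₂)(x) for all x ∈ ℝ, where Θ_L(y) = L·Θ(Ly). -/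
open MeasureTheory Real Set
open scoped ENNReal NNReal

noncomputable section

open FourierTransform in
lemma aux_zero_pos (Θ : SchwartzMap ℝ ℝ) (hΘpos : ∀ x, 0 ≤ Θ x) (hΘne : ∃ x, Θ x ≠ 0)
    (hFT : ∀ ξ : ℝ, 0 ≤ (FTr (fun x => (Θ x : ℂ)) ξ).re ∧
      (FTr (fun x => (Θ x : ℂ)) ξ).im = 0) : 0 < Θ 0 := by
  obtain ⟨x₀, hx₀⟩ := hΘne
  let F : SchwartzMap ℝ ℂ := SchwartzMap.postcompCLM Complex.ofRealCLM Θ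
  have hF : ∀ x, F x = (Θ x : ℂ) := fun x => rfl
  have h1 : ∀ w, (𝓕 F : SchwartzMap ℝ ℂ) w = FTr (fun x => (Θ x : ℂ)) (2 * π * w) := by
    intro w
    rw [SchwartzMap.fourier_coe, Real.fourier_eq']
    unfold FTr
    congr 1
    ext x
    rw [hF, smul_eq_mul, mul_comm]
    congr 2
    simp
    ring
  have h2 : F 0 = ∫ w, (𝓕 F : SchwartzMap ℝ ℂ) w := by
    have h : 𝓕⁻ (𝓕 F : SchwartzMap ℝ ℂ) = F := FourierTransform.fourierInv_fourier_eq F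
    have h' := congrArg (fun G : SchwartzMap ℝ ℂ => G 0) h
    rw [← h', SchwartzMap.fourierInv_coe, Real.fourierInv_eq']
    simp
  have h3 : Θ 0 = ∫ w, ((𝓕 F : SchwartzMap ℝ ℂ) w).re := by
    have h := integral_re (𝕜 := ℂ) (𝓕 F : SchwartzMap ℝ ℂ).integrable (μ := volume)
    simp only [RCLike.re_eq_complex_re] at h
    rw [h, ← h2, hF, Complex.ofReal_re]
  rw [h3]
  refine integral_pos_of_integrable_nonneg_nonzero (x := (0:ℝ)) ?_ ?_ ?_ ?_
  · exact Complex.continuous_re.comp (𝓕 F : SchwartzMap ℝ ℂ).continuous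
  · exact (𝓕 F : SchwartzMap ℝ ℂ).integrable.re
  · intro w
    simp only [h1]
    exact (hFT _).1
  · rw [h1]
    have : FTr (fun x => (Θ x : ℂ)) (2 * π * 0) = ((∫ x, Θ x : ℝ) : ℂ) := by
      unfold FTr
      rw [← integral_complex_ofReal]
      simp
    rw [this, Complex.ofReal_re]
    exact ne_of_gt (integral_pos_of_integrable_nonneg_nonzero Θ.continuous Θ.integrable hΘpos hx₀)

/-- If `Θ ≥ 0` is a nonzero Schwartz function with nonnegative Fourier transform
and `a > 0`, then there is `C > 0` so that for `L > 0`, `δ ≥ a/L` and continuous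
`w₁ ≥ 0`, the local supremum `w₂(x) = sup_{|x'−x| ≤ δ} w₁(x')` satisfies
`w₂ ≤ C (Θ_L * w₂)` pointwise, where `Θ_L(y) = LΘ(Ly)`. -/
theorem stmt16 (Θ : SchwartzMap ℝ ℝ) (hΘpos : ∀ x, 0 ≤ Θ x) (hΘne : ∃ x, Θ x ≠ 0)
    (hFT : ∀ ξ : ℝ, 0 ≤ (FTr (fun x => (Θ x : ℂ)) ξ).re ∧
      (FTr (fun x => (Θ x : ℂ)) ξ).im = 0)
    (a : ℝ) (ha : 0 < a) :
    ∃ C : ℝ, 0 < C ∧ ∀ L : ℝ, 0 < L → ∀ δ : ℝ, a / L ≤ δ →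
      ∀ w₁ : ℝ → ℝ, Continuous w₁ → (∀ x, 0 ≤ w₁ x) →
      ∀ x : ℝ,
        ENNReal.ofReal (sSup (w₁ '' Metric.closedBall x δ)) ≤
          ENNReal.ofReal C * ∫⁻ y : ℝ, ENNReal.ofReal (L * Θ (L * y)) *
            ENNReal.ofReal (sSup (w₁ '' Metric.closedBall (x - y) δ)) := by
  have h0 := aux_zero_pos Θ hΘpos hΘne hFT
  obtain ⟨r, hr, hra, hrc⟩ : ∃ r : ℝ, 0 < r ∧ r ≤ a ∧ ∀ y, |y| ≤ r → Θ 0 / 2 ≤ Θ y := by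
    have hc : ∀ᶠ y in nhds (0:ℝ), Θ 0 / 2 < Θ y :=
      Θ.continuous.continuousAt.eventually (lt_mem_nhds (by linarith))
    obtain ⟨ε, hε, h⟩ := Metric.eventually_nhds_iff.1 hc
    refine ⟨min (ε / 2) a, by positivity, min_le_right _ _, fun y hy => (h ?_).le⟩
    rw [Real.dist_eq, sub_zero]
    have := min_le_left (ε / 2) a
    linarith
  set c := Θ 0 / 2 with hcdef
  have hcpos : 0 < c := by positivity
  refine ⟨1 / (r * c), by positivity, ?_⟩
  intro L hL δ hδ w₁ hw hw0 x
  have hδ0 : 0 ≤ δ := le_trans (by positivity) hδ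
  have hrL : r / L ≤ δ := le_trans (by gcongr) hδ
  have hrL0 : 0 < r / L := by positivity
  obtain ⟨x', hx', hmax⟩ := (isCompact_closedBall x δ).exists_sSup_image_eq
    ⟨x, Metric.mem_closedBall_self hδ0⟩ hw.continuousOn
  rw [hmax]
  rw [Metric.mem_closedBall, Real.dist_eq, abs_le] at hx'
  have key : ∀ y, |y| ≤ r / L → |x' - (x - y)| ≤ δ →
      ENNReal.ofReal (L * c * w₁ x') ≤ ENNReal.ofReal (L * Θ (L * y)) *
            ENNReal.ofReal (sSup (w₁ '' Metric.closedBall (x - y) δ)) := by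
    intro y hy hy2
    rw [← ENNReal.ofReal_mul (mul_nonneg hL.le (hΘpos _))]
    apply ENNReal.ofReal_le_ofReal
    have e1 : c ≤ Θ (L * y) := by
      apply hrc
      rw [abs_mul, abs_of_pos hL]
      rw [le_div_iff₀ hL] at hy
      linarith
    have e2 : w₁ x' ≤ sSup (w₁ '' Metric.closedBall (x - y) δ) := by
      apply le_csSup ((isCompact_closedBall _ _).image hw).bddAbove
      exact ⟨x', by rwa [Metric.mem_closedBall, Real.dist_eq], rfl⟩
    exact mul_le_mul (by gcongr) e2 (hw0 _) (mul_nonneg hL.le (hΘpos _))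
  obtain ⟨S, hS, hvol, hSy⟩ : ∃ S : Set ℝ, MeasurableSet S ∧ volume S = ENNReal.ofReal (r / L) ∧
      ∀ y ∈ S, |y| ≤ r / L ∧ |x' - (x - y)| ≤ δ := by
    rcases le_total x' x with h | h
    · refine ⟨Icc 0 (r / L), measurableSet_Icc, by simp, fun y hy => ?_⟩
      obtain ⟨h1, h2⟩ := hy
      constructor <;> rw [abs_le] <;> constructor <;> linarith
    · refine ⟨Icc (-(r / L)) 0, measurableSet_Icc, by simp, fun y hy => ?_⟩
      obtain ⟨h1, h2⟩ := hy
      constructor <;> rw [abs_le] <;> constructor <;> linarith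
  calc ENNReal.ofReal (w₁ x')
      = ENNReal.ofReal (1 / (r * c)) * (ENNReal.ofReal (L * c * w₁ x') * volume S) := by
        have := hw0 x'
        rw [hvol, ← ENNReal.ofReal_mul (by positivity), ← ENNReal.ofReal_mul (by positivity)]
        congr 1
        field_simp
    _ = ENNReal.ofReal (1 / (r * c)) * ∫⁻ y in S, ENNReal.ofReal (L * c * w₁ x') := by
        rw [setLIntegral_const]
    _ ≤ ENNReal.ofReal (1 / (r * c)) * ∫⁻ y in S, ENNReal.ofReal (L * Θ (L * y)) *
            ENNReal.ofReal (sSup (w₁ '' Metric.closedBall (x - y) δ)) := by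
        gcongr 1
        exact setLIntegral_mono' hS fun y hy => key y (hSy y hy).1 (hSy y hy).2
    _ ≤ _ := by
        gcongr 1
        exact setLIntegral_le_lintegral _ _
end
end

section
/- There exists a constant C > 0 (depending only on ℓ and P) such that ‖ℳ_ℓ¹a‖_{L¹(ℝ)} ≤ C for every H¹-atom a. -/
open MeasureTheory Real Set
open scoped ENNReal NNReal

noncomputable section

/-- The maximal operator `ℳ_ℓ¹`:
`ℳ_ℓ¹φ(x) = sup_{(y,r) ∈ Γ̃_ℓ(x)} r^{ℓ/(ℓ-1)} |(P_r * φ)(y)|` where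
`Γ̃_ℓ(x) = {(y,r) : 0 < r ≤ 1, |y − x| ≤ r^{-1/(ℓ-1)}}` and `P_r(x) = r⁻¹P(x/r)`. -/
def Mbeta (ℓ : ℕ) (P : ℝ → ℝ) (a : ℝ → ℂ) : ℝ → ℝ≥0∞ := fun x =>
  ⨆ (yr : ℝ × ℝ) (_ : 0 < yr.2 ∧ yr.2 ≤ 1 ∧
      |yr.1 - x| ≤ yr.2 ^ (-1 / ((ℓ : ℝ) - 1))),
    ENNReal.ofReal (yr.2 ^ ((ℓ : ℝ) / ((ℓ : ℝ) - 1)) *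
      ‖∫ t : ℝ, ((yr.2⁻¹ * P ((yr.1 - t) / yr.2) : ℝ) : ℂ) * a t‖)

lemma core_real (m : ℕ) (ρ lam K q : ℝ) (hρ : 0 < ρ) (hρ1 : ρ ≤ 1) (hlam : 0 < lam) (hK : 0 ≤ K)
    (h1 : q ≤ K * (ρ ^ (m+2) / lam ^ (m+1)))
    (h2 : q ≤ K * (ρ ^ (m+2) * (lam ^ (m+1) / (ρ ^ (m+1))^2))) :
    q ≤ K * (max (lam ^ (m+1)) lam⁻¹)⁻¹ := by
  rcases le_total 1 lam with h | h
  · have : max (lam ^ (m+1)) lam⁻¹ = lam ^ (m+1) :=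
      max_eq_left ((inv_le_one_of_one_le₀ h).trans (one_le_pow₀ h))
    rw [this]
    refine h1.trans (mul_le_mul_of_nonneg_left ?_ hK)
    rw [div_eq_mul_inv]
    exact mul_le_of_le_one_left (by positivity) (pow_le_one₀ hρ.le hρ1)
  · have : max (lam ^ (m+1)) lam⁻¹ = lam⁻¹ :=
      max_eq_right ((pow_le_one₀ hlam.le h).trans ((one_le_inv₀ hlam).2 h))
    rw [this, inv_inv]
    rcases le_total ρ lam with hr | hr
    · refine h1.trans (mul_le_mul_of_nonneg_left ?_ hK)
      rw [div_le_iff₀ (by positivity)]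
      calc ρ ^ (m+2) ≤ lam ^ (m+2) := pow_le_pow_left₀ hρ.le hr _
        _ = _ := by ring
    · refine h2.trans (mul_le_mul_of_nonneg_left ?_ hK)
      rw [← mul_div_assoc, div_le_iff₀ (by positivity)]
      calc ρ ^ (m+2) * lam ^ (m+1) = ρ^(m+2) * lam * lam^m := by ring
        _ ≤ ρ^(m+2) * lam * ρ^m := by gcongr
        _ = _ := by ring

lemma core_real2 (m : ℕ) (ρ lam K q M D : ℝ) (hρ : 0 < ρ) (hρ1 : ρ ≤ 1) (hlam : 0 < lam)
    (hK : 0 ≤ K) (hM : 1 ≤ M) (hD0 : 0 ≤ D)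
    (h1 : q ≤ K * (ρ ^ (m+2) / lam ^ (m+1)))
    (h2 : q ≤ K * (ρ ^ (m+2) * (lam ^ (m+1) / (ρ ^ (m+1))^2)))
    (h3 : lam ^ (m+1) < D → M < D * ρ → q ≤ 0) :
    q ≤ 2 * K * M ^ (m+2) * ((max (lam ^ (m+1)) lam⁻¹)⁻¹ *
      (1 + (D / max (lam ^ (m+1)) lam⁻¹)^2)⁻¹) := by
  have h0 := core_real m ρ lam K q hρ hρ1 hlam hK h1 h2
  set A := max (lam ^ (m+1)) lam⁻¹ with hA
  have hA0 : 0 < A := lt_max_of_lt_right (by positivity)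
  have hMp : 1 ≤ M ^ (m+2) := one_le_pow₀ hM
  rcases le_or_gt D A with h | h
  · have e : 1/2 ≤ (1 + (D/A)^2)⁻¹ := by
      rw [one_div]
      apply inv_anti₀ (by positivity)
      have : (D/A)^2 ≤ 1 := pow_le_one₀ (by positivity) ((div_le_one hA0).2 h)
      linarith
    calc q ≤ K * A⁻¹ := h0
      _ = 2 * K * 1 * (A⁻¹ * (1/2)) := by ring
      _ ≤ _ := by gcongr
  · have hDp : 0 < D := hA0.trans h
    have hAl : lam ^ (m+1) ≤ A := le_max_left _ _
    have hnn : 0 ≤ 2 * K * M ^ (m+2) * (A⁻¹ * (1 + (D / A)^2)⁻¹) := by positivity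
    rcases lt_or_ge M (D*ρ) with h4 | h4
    · exact (h3 (hAl.trans_lt h) h4).trans hnn
    have hρM : ρ ≤ M / D := by rw [le_div_iff₀ hDp]; linarith
    have hl : (lam ^ (m+1))⁻¹ ≤ A ^ (m+1) := by
      rw [← inv_pow]; exact pow_le_pow_left₀ (by positivity) (le_max_right _ _) _
    have hAD : A / D ≤ 1 := (div_le_one hDp).2 h.le
    have e2 : (A/D)^2 ≤ 2 * (1 + (D/A)^2)⁻¹ := by
      rw [← div_eq_mul_inv, le_div_iff₀ (by positivity)]
      have e3 : (A/D)^2 * (1 + (D/A)^2) = (A/D)^2 + 1 := by field_simp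
      have : (A/D)^2 ≤ 1 := pow_le_one₀ (by positivity) hAD
      linarith
    calc q ≤ K * (ρ ^ (m+2) * (lam ^ (m+1))⁻¹) := by rw [← div_eq_mul_inv]; exact h1
      _ ≤ K * ((M/D) ^ (m+2) * A ^ (m+1)) := by gcongr
      _ = K * M^(m+2) * (A⁻¹ * ((A/D)^2 * (A/D)^m)) := by
          rw [← pow_add, Nat.add_comm 2 m, div_pow, div_pow]
          field_simp
          ring
      _ ≤ K * M^(m+2) * (A⁻¹ * ((A/D)^2 * 1)) := by
          gcongr; exact pow_le_one₀ (by positivity) hAD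
      _ ≤ K * M^(m+2) * (A⁻¹ * (2 * (1 + (D/A)^2)⁻¹)) := by rw [mul_one]; gcongr
      _ = _ := by ring

lemma bound_a (P : ℝ → ℝ) (hPi : Integrable P) (hPnonneg : ∀ x, 0 ≤ P x)
    (a : ℝ → ℂ) (L y r : ℝ) (hr : 0 < r)
    (hb : ∀ᵐ x ∂(volume : Measure ℝ), ‖a x‖ ≤ L⁻¹) :
    ‖∫ t : ℝ, ((r⁻¹ * P ((y - t) / r) : ℝ) : ℂ) * a t‖ ≤ (∫ x, P x) * L⁻¹ := by
  have hi : Integrable (fun t => P ((y - t) / r)) :=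
    (hPi.comp_div hr.ne').comp_sub_left y
  have hI : ∫ t, P ((y - t) / r) = r * ∫ x, P x := by
    rw [integral_sub_left_eq_self (fun t => P (t / r)) volume y, Measure.integral_comp_div,
      abs_of_pos hr, smul_eq_mul]
  calc _ ≤ ∫ t, (r⁻¹ * P ((y - t) / r)) * L⁻¹ := by
        apply norm_integral_le_of_norm_le ((hi.const_mul _).mul_const _)
        filter_upwards [hb] with t ht
        rw [norm_mul, Complex.norm_real, Real.norm_eq_abs,
          abs_of_nonneg (mul_nonneg (inv_nonneg.2 hr.le) (hPnonneg _))]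
        exact mul_le_mul_of_nonneg_left ht (mul_nonneg (inv_nonneg.2 hr.le) (hPnonneg _))
    _ = _ := by
        rw [integral_mul_const, integral_const_mul, hI]; field_simp

lemma bound_c (P : ℝ → ℝ) (hPcont : Continuous P) (B : ℝ≥0) (hLip : LipschitzWith B P)
    (a : ℝ → ℂ) (c d y r : ℝ) (hcd : c < d) (hr : 0 < r) (ham : Measurable a)
    (hs : ∀ x ∉ Set.Icc c d, a x = 0)
    (hb : ∀ᵐ x ∂(volume : Measure ℝ), ‖a x‖ ≤ (d - c)⁻¹) (h0 : ∫ x, a x = 0) :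
    ‖∫ t : ℝ, ((r⁻¹ * P ((y - t) / r) : ℝ) : ℂ) * a t‖ ≤ B * ((d - c) / r ^ 2) := by
  have hL : 0 < d - c := sub_pos.2 hcd
  have hsub : Function.support a ⊆ Icc c d := by
    intro x hx; by_contra h; exact hx (hs x h)
  have hai : IntegrableOn a (Icc c d) :=
    Measure.integrableOn_of_bounded (by simp) ham.aestronglyMeasurable
      (ae_restrict_of_ae hb)
  have hai' : Integrable a := (integrableOn_iff_integrable_of_support_subset hsub).1 hai
  have hgi : IntegrableOn (fun t => ((r⁻¹ * P ((y - t) / r) : ℝ) : ℂ) * a t) (Icc c d) := by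
    apply hai.continuousOn_mul _ isCompact_Icc
    fun_prop
  have hgi' : Integrable (fun t => ((r⁻¹ * P ((y - t) / r) : ℝ) : ℂ) * a t) := by
    apply (integrableOn_iff_integrable_of_support_subset _).1 hgi
    intro x hx; apply hsub; intro h; apply hx; simp [h]
  have e : ∫ t : ℝ, ((r⁻¹ * P ((y - t) / r) : ℝ) : ℂ) * a t
      = ∫ t in Icc c d, ((r⁻¹ * P ((y - t) / r) : ℝ) : ℂ) * a t
          - ((r⁻¹ * P ((y - c) / r) : ℝ) : ℂ) * a t := by
    rw [setIntegral_eq_integral_of_forall_compl_eq_zero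
      (by intro x hx; simp [hs x hx]), integral_sub hgi' (hai'.const_mul _),
      integral_const_mul, h0]
    simp
  rw [e]
  calc _ ≤ (B * (1 / r^2)) * volume.real (Icc c d) := by
        apply norm_setIntegral_le_of_norm_le_const_ae' (by simp)
        filter_upwards [hb] with t ht hmem
        rw [← sub_mul, ← Complex.ofReal_sub, norm_mul, Complex.norm_real, ← mul_sub, norm_mul]
        have h1 := hLip.norm_sub_le ((y - t) / r) ((y - c) / r)
        have h2 : ‖(y - t) / r - (y - c) / r‖ ≤ (d - c) / r := by
          rw [← sub_div, norm_div, Real.norm_eq_abs, Real.norm_eq_abs, abs_of_pos hr]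
          gcongr
          rw [abs_le]; constructor <;> linarith [hmem.1, hmem.2]
        rw [Real.norm_eq_abs, abs_of_pos (inv_pos.2 hr)]
        calc _ ≤ r⁻¹ * (B * ((d - c) / r)) * (d - c)⁻¹ := by gcongr; exact h1.trans (by gcongr)
          _ = _ := by field_simp
    _ = _ := by
        rw [Real.volume_real_Icc_of_le hcd.le]; ring

lemma lint_bound (A c0 N : ℝ) (hA : 0 < A) (hN : 0 ≤ N) :
    ∫⁻ x, ENNReal.ofReal (N * (A⁻¹ * (1 + (|x - c0| / A)^2)⁻¹)) = ENNReal.ofReal (N * π) := by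
  have e : (fun x : ℝ => N * (A⁻¹ * (1 + (|x - c0| / A)^2)⁻¹))
      = fun x => N * (A⁻¹ * (1 + ((x - c0) / A)^2)⁻¹) := by
    ext x; rw [div_pow, div_pow, sq_abs]
  have hi : Integrable (fun x : ℝ => N * (A⁻¹ * (1 + ((x - c0) / A)^2)⁻¹)) :=
    (((integrable_inv_one_add_sq.comp_div hA.ne').comp_sub_right c0).const_mul _).const_mul _
  have hI : ∫ x, N * (A⁻¹ * (1 + ((x - c0) / A)^2)⁻¹) = N * π := by
    rw [integral_const_mul, integral_const_mul,
      integral_sub_right_eq_self (fun t => (1 + (t / A)^2)⁻¹) c0,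
      Measure.integral_comp_div (fun t => (1 + t^2)⁻¹), integral_univ_inv_one_add_sq,
      abs_of_pos hA, smul_eq_mul]
    field_simp
  simp_rw [fun x => congrFun e x]
  rw [← ofReal_integral_eq_lintegral_ofReal hi (Filter.Eventually.of_forall fun x => by positivity),
    hI]

/-- Uniform `L¹` bound for `ℳ_ℓ¹` on `H¹`-atoms: `‖ℳ_ℓ¹a‖_{L¹} ≤ C` for every atom `a`,
i.e. every `a` supported in a bounded interval `I` with `|a| ≤ |I|⁻¹` and `∫ a = 0`. -/
theorem stmt19 (ℓ : ℕ) (hℓ : 2 ≤ ℓ)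
    (P : ℝ → ℝ) (hP : ContDiff ℝ (⊤ : ℕ∞) P) (hPc : HasCompactSupport P)
    (hPnonneg : ∀ x, 0 ≤ P x) (hPpos : ∀ x ∈ Set.Icc (-1 : ℝ) 1, 0 < P x) :
    ∃ C : ℝ, 0 < C ∧ ∀ (a : ℝ → ℂ) (c d : ℝ), c < d → Measurable a →
      (∀ x ∉ Set.Icc c d, a x = 0) →
      (∀ᵐ x ∂(volume : Measure ℝ), ‖a x‖ ≤ (d - c)⁻¹) →
      (∫ x : ℝ, a x) = 0 →
      ∫⁻ x : ℝ, Mbeta ℓ P a x ≤ ENNReal.ofReal C := by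
  obtain ⟨m, rfl⟩ : ∃ m, ℓ = m + 2 := ⟨ℓ - 2, by omega⟩
  have hPi : Integrable P := hP.continuous.integrable_of_hasCompactSupport hPc
  obtain ⟨B, hLip⟩ : ∃ B, LipschitzWith B P :=
    (hP.of_le (by exact_mod_cast le_top)).lipschitzWith_of_hasCompactSupport hPc one_ne_zero
  obtain ⟨R0, hR0⟩ := hPc.isCompact.isBounded.exists_norm_le
  set R := max R0 1 with hRdef
  have hR1 : 1 ≤ R := le_max_right _ _
  have hR : ∀ x, R < |x| → P x = 0 := by
    intro x hx
    by_contra h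
    have := hR0 x (subset_tsupport P h)
    rw [Real.norm_eq_abs] at this
    exact absurd (this.trans (le_max_left _ _)) (not_le.2 hx)
  set K := (∫ x, P x) + B with hKdef
  have hIP : 0 ≤ ∫ x, P x := integral_nonneg hPnonneg
  have hK : 0 ≤ K := add_nonneg hIP B.2
  set M := 2 * (R + 1) with hMdef
  have hM : 1 ≤ M := by linarith
  set N := 2 * K * M ^ (m+2) with hN
  have hN0 : 0 ≤ N := by positivity
  refine ⟨N * π + 1, by positivity, ?_⟩
  intro a c d hcd ham hs hb h0
  have hL : 0 < d - c := sub_pos.2 hcd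
  set lam := (d - c) ^ (1 / ((m:ℝ)+1)) with hlam
  have hlam0 : 0 < lam := by positivity
  have hm0 : (m:ℝ) + 1 ≠ 0 := by positivity
  have hlamp : lam ^ (m+1) = d - c := by
    rw [hlam, ← Real.rpow_natCast, ← Real.rpow_mul hL.le]
    push_cast
    rw [one_div_mul_cancel hm0, Real.rpow_one]
  set A := max (lam ^ (m+1)) lam⁻¹ with hA
  have hA0 : 0 < A := lt_max_of_lt_right (by positivity)
  refine le_trans ?_ ((lint_bound A ((c+d)/2) N hA0 hN0).le.trans
    (ENNReal.ofReal_le_ofReal (by linarith)))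
  apply lintegral_mono
  intro x
  unfold Mbeta
  refine iSup₂_le ?_
  rintro ⟨y, r⟩ ⟨hr, hr1, hxy⟩
  dsimp only at hr hr1 hxy ⊢
  apply ENNReal.ofReal_le_ofReal
  set ρ := r ^ (1 / ((m:ℝ)+1)) with hρ
  have hρ0 : 0 < ρ := by positivity
  have hρ1 : ρ ≤ 1 := Real.rpow_le_one hr.le hr1 (by positivity)
  have hρp : ρ ^ (m+1) = r := by
    rw [hρ, ← Real.rpow_natCast, ← Real.rpow_mul hr.le]
    push_cast
    rw [one_div_mul_cancel hm0, Real.rpow_one]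
  have hcast : (((m + 2 : ℕ) : ℝ) - 1) = (m:ℝ) + 1 := by push_cast; ring
  have e1 : r ^ (((m + 2 : ℕ) : ℝ) / (((m + 2 : ℕ) : ℝ) - 1)) = ρ ^ (m+2) := by
    rw [hcast, hρ, ← Real.rpow_natCast, ← Real.rpow_mul hr.le]
    congr 1
    ring
  have e2 : r ^ (-1 / (((m + 2 : ℕ) : ℝ) - 1)) = ρ⁻¹ := by
    rw [hcast, hρ, ← Real.rpow_neg hr.le]
    congr 1
    ring
  rw [e1]
  rw [e2] at hxy
  have ha := bound_a P hPi hPnonneg a (d - c) y r hr hb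
  have hc := bound_c P hP.continuous B hLip a c d y r hcd hr ham hs hb h0
  apply core_real2 m ρ lam K _ M |x - (c+d)/2| hρ0 hρ1 hlam0 hK hM (abs_nonneg _)
  · rw [hlamp]
    calc _ ≤ ρ ^ (m+2) * ((∫ x, P x) * (d-c)⁻¹) := by gcongr
      _ ≤ ρ ^ (m+2) * (K * (d-c)⁻¹) := by
        gcongr
        exact le_add_of_nonneg_right B.2
      _ = _ := by ring
  · rw [hlamp, hρp]
    calc _ ≤ ρ ^ (m+2) * (B * ((d - c) / r ^ 2)) := by gcongr
      _ ≤ ρ ^ (m+2) * (K * ((d - c) / r ^ 2)) := by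
        gcongr
        exact le_add_of_nonneg_left hIP
      _ = _ := by ring
  · intro hD hMD
    rw [hlamp] at hD
    have hz : ∀ t, ((r⁻¹ * P ((y - t) / r) : ℝ) : ℂ) * a t = 0 := by
      intro t
      by_cases ht : t ∈ Icc c d
      · have hMD' : M * ρ⁻¹ < |x - (c+d)/2| := by
          rw [← div_eq_mul_inv, div_lt_iff₀ hρ0]; exact hMD
        have hinv : 1 ≤ ρ⁻¹ := (one_le_inv₀ hρ0).2 hρ1
        have ht' : |t - (c+d)/2| ≤ (d-c)/2 := by
          rw [abs_le]; constructor <;> linarith [ht.1, ht.2]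
        have htri : |x - (c+d)/2| ≤ |y - x| + |y - t| + |t - (c+d)/2| := by
          have h1 := abs_sub_le x y ((c+d)/2)
          have h2 := abs_sub_le y t ((c+d)/2)
          rw [abs_sub_comm x y] at h1
          linarith
        have hRi : R * 1 ≤ R * ρ⁻¹ := by gcongr
        have hRr : R * r ≤ R * 1 := by gcongr
        have hMe : M * ρ⁻¹ = 2 * (R * ρ⁻¹) + 2 * ρ⁻¹ := by rw [hMdef]; ring
        have hfar : R * r < |y - t| := by linarith
        rw [hR ((y - t)/r) (by rw [abs_div, abs_of_pos hr, lt_div_iff₀ hr]; exact hfar)]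
        simp
      · simp [hs t ht]
    rw [integral_congr_ae (Filter.Eventually.of_forall hz)]
    simp
end
end
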